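/- arXiv:1810.02271 — 2 statements merged into one kernel-verified Lean document; each statement's English description precedes it below -/
import Mathlib

section
/- Let H be a real Hilbert space, V ⊆ H a subspace, a : H × H → ℝ a bilinear form, and ν > 0. Suppose u, u_h, y, p ∈ H and y_h, p_h, y^h, p^h ∈ V satisfy: (i) a(y_h − y^h, v) = ⟪u_h − u, v⟫ for all v ∈ V; (ii) a(v, p_h − p^h) = ⟪y_h − y, v⟫ for all v ∈ V; (iii) ⟪ν(u − u_h) + (p − p_h), u_h − u⟫ ≥ 0. Then ν ‖u − u_h‖² + ‖y − y_h‖² ≤ (1/ν) ‖p − p^h‖² + ‖y − y^h‖². -/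
open RealInnerProductSpace

/-- Abstract form of estimate (4.4) in Theorem 4.1: from the state and adjoint error
equations and the added variational inequalities one gets
`ν ‖u − u_h‖² + ‖y − y_h‖² ≤ (1/ν) ‖p − pʰ‖² + ‖y − yʰ‖²`. -/
theorem stmt12 {H : Type*} [NormedAddCommGroup H] [InnerProductSpace ℝ H]
    (V : Submodule ℝ H) (a : H →ₗ[ℝ] H →ₗ[ℝ] ℝ) (ν : ℝ) (hν : 0 < ν)
    (u uh y p : H) (yh ph yH pH : H)
    (hyh : yh ∈ V) (hph : ph ∈ V) (hyH : yH ∈ V) (hpH : pH ∈ V)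
    (hstate : ∀ v ∈ V, a (yh - yH) v = ⟪uh - u, v⟫)
    (hadjoint : ∀ v ∈ V, a v (ph - pH) = ⟪yh - y, v⟫)
    (hVI : 0 ≤ ⟪ν • (u - uh) + (p - ph), uh - u⟫) :
    ν * ‖u - uh‖ ^ 2 + ‖y - yh‖ ^ 2 ≤ (1 / ν) * ‖p - pH‖ ^ 2 + ‖y - yH‖ ^ 2 := by
  have hcross : ⟪uh - u, ph - pH⟫ = ⟪yh - y, yh - yH⟫ :=
    (hstate _ (V.sub_mem hph hpH)).symm.trans (hadjoint _ (V.sub_mem hyh hyH))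
  have hcontrol : ν * ‖u - uh‖ ^ 2 + ⟪yh - y, yh - yH⟫ ≤ ⟪uh - u, p - pH⟫ := by
    have hsplit : ν • (u - uh) + (p - ph) = -(ν • (uh - u)) + (p - pH) - (ph - pH) := by
      module
    rw [hsplit, inner_sub_left, inner_add_left, inner_neg_left, real_inner_smul_left,
      real_inner_self_eq_norm_sq, real_inner_comm, real_inner_comm _ (ph - pH), hcross,
      norm_sub_rev uh u] at hVI
    linarith
  have hyoung : 2 * ⟪uh - u, p - pH⟫ ≤ ν * ‖u - uh‖ ^ 2 + (1 / ν) * ‖p - pH‖ ^ 2 := by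
    have hsq := norm_sub_sq_real (ν • (uh - u)) (p - pH)
    rw [real_inner_smul_left, norm_smul, Real.norm_of_nonneg hν.le, norm_sub_rev uh u] at hsq
    have hdiv : ν * ‖u - uh‖ ^ 2 + (1 / ν) * ‖p - pH‖ ^ 2 - 2 * ⟪uh - u, p - pH⟫ =
        ‖ν • (uh - u) - (p - pH)‖ ^ 2 / ν := by
      rw [hsq]
      field_simp
      ring
    have hnonneg : 0 ≤ ‖ν • (uh - u) - (p - pH)‖ ^ 2 / ν := by positivity
    linarith
  have hpolar : ‖y - yH‖ ^ 2 = ‖yh - yH‖ ^ 2 - 2 * ⟪yh - y, yh - yH⟫ + ‖y - yh‖ ^ 2 := by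
    have hsq := norm_sub_sq_real (yh - yH) (yh - y)
    rwa [sub_sub_sub_cancel_left, real_inner_comm, norm_sub_rev yh y] at hsq
  linarith [sq_nonneg ‖yh - yH‖]
end

section
/- Let H be a real Hilbert space, V ⊆ H a subspace, N : H → ℝ a seminorm with ‖v‖ ≤ N(v) for all v ∈ H, α > 0, and a : H × H → ℝ a bilinear form with α N(v)² ≤ a(v, v) for all v ∈ V. Suppose y, p ∈ H and p_h, p^h ∈ V satisfy a(v, p_h − p^h) = ⟪y_h − y, v⟫ for all v ∈ V, where y_h ∈ V. Then ‖p − p_h‖ ≤ ‖p − p^h‖ + (1/α) ‖y − y_h‖ and N(p − p_h) ≤ N(p − p^h) + (1/α) ‖y − y_h‖. -/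
open RealInnerProductSpace

/-- Abstract form of estimates (4.5) and (4.7) in Theorem 4.1 for the co-state:
if `a` is coercive on `V` w.r.t. the norm `N` dominating `‖·‖`, and the adjoint error
equation `a(v, p_h − pʰ) = ⟪y_h − y, v⟫` holds for all `v ∈ V`, then
`‖p − p_h‖ ≤ ‖p − pʰ‖ + (1/α)‖y − y_h‖` and `N(p − p_h) ≤ N(p − pʰ) + (1/α)‖y − y_h‖`. -/
theorem stmt14 {H : Type*} [NormedAddCommGroup H] [InnerProductSpace ℝ H]
    (V : Submodule ℝ H) (N : Seminorm ℝ H) (hN : ∀ v : H, ‖v‖ ≤ N v)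
    (α : ℝ) (hα : 0 < α) (a : H →ₗ[ℝ] H →ₗ[ℝ] ℝ)
    (hcoer : ∀ v ∈ V, α * (N v) ^ 2 ≤ a v v)
    (y p : H) (ph pH yh : H) (hph : ph ∈ V) (hpH : pH ∈ V) (hyh : yh ∈ V)
    (hadjoint : ∀ v ∈ V, a v (ph - pH) = ⟪yh - y, v⟫) :
    ‖p - ph‖ ≤ ‖p - pH‖ + (1 / α) * ‖y - yh‖ ∧
    N (p - ph) ≤ N (p - pH) + (1 / α) * ‖y - yh‖ := by
  have hmem : ph - pH ∈ V := V.sub_mem hph hpH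
  have hbound : N (ph - pH) ≤ (1 / α) * ‖y - yh‖ := by
    have henergy : α * N (ph - pH) ^ 2 ≤ ‖y - yh‖ * N (ph - pH) :=
      calc α * N (ph - pH) ^ 2 ≤ a (ph - pH) (ph - pH) := hcoer _ hmem
        _ = ⟪yh - y, ph - pH⟫ := hadjoint _ hmem
        _ ≤ ‖yh - y‖ * ‖ph - pH‖ := real_inner_le_norm _ _
        _ = ‖y - yh‖ * ‖ph - pH‖ := by rw [norm_sub_rev]
        _ ≤ ‖y - yh‖ * N (ph - pH) := by gcongr; exact hN _
    rw [one_div_mul_eq_div, le_div_iff₀ hα]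
    rcases (apply_nonneg N (ph - pH)).eq_or_lt with h0 | hpos
    · rw [← h0, zero_mul]
      exact norm_nonneg _
    · refine le_of_mul_le_mul_right ?_ hpos
      linarith
  have hsplit : p - ph = (p - pH) - (ph - pH) := by abel
  rw [hsplit]
  constructor
  · linarith [norm_sub_le (p - pH) (ph - pH), hN (ph - pH)]
  · linarith [map_sub_le_add N (p - pH) (ph - pH)]
end
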